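/- Let G be a finite group acting homogeneously on a free k-category L_k(V) over a family of finite-dimensional kG-modules, trivially on objects. Let U = {_yU_x} be the family with {}_yU_x = ⊕_{γ ∈ yQx} [V_γ^G]_irr, the direct sum over oriented paths γ in the track-quiver from x to y of chosen spaces of irreducible invariants of the tensor product V_γ. Then the canonical functor F : L_k(U) → L_k(V)^G given by the universal property is an isomorphism of k-categories; in particular the invariant category of a free k-category is free. -/

import Mathlib

set_option synthInstance.maxHeartbeats 1000000
set_option maxHeartbeats 1000000

/-!
STATEMENT 12: Let a finite group `G` act homogeneously (trivially on objects) on a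
free `k`-category `L_k(V)` over a family of finite-dimensional `kG`-modules
`{}_yV_x`.  For each sequence (oriented path of the track-quiver) `γ`, let
`[V_γ^G]_irr` be a chosen complement of the composite invariants inside `V_γ^G`.
Then the canonical functor `F : L_k(U) → L_k(V)^G`, from the free `k`-category on
the family `{}_yU_x = ⊕_γ [V_γ^G]_irr`, given by the universal property, is an
isomorphism of categories: it is the identity on objects and, on each morphism
space, the assembled multiplication map from the direct sum over all factorizations
of sequences into positive pieces of the tensor products of the chosen irreducible
subspaces is injective with image exactly the invariant subspace `⊕_γ V_γ^G`.
In particular the invariant category of a free `k`-category is free.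
-/

open scoped TensorProduct DirectSum Classical

section FreeLinearCategory

/-- A sequence of objects `x = u_0, u_1, …, u_n = y`, indexing a summand of a
morphism space of the free `k`-category on a family of vector spaces. -/
inductive OSeq (V₀ : Type) : V₀ → V₀ → Type
  | nil (x : V₀) : OSeq V₀ x x
  | snoc {x y : V₀} (p : OSeq V₀ x y) (z : V₀) : OSeq V₀ x z

variable {V₀ : Type}

/-- Concatenation of sequences. -/
noncomputable def OSeq.comp {x y : V₀} (p : OSeq V₀ x y) : ∀ {z : V₀}, OSeq V₀ y z → OSeq V₀ x z :=
  fun {z} q =>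
    OSeq.rec (motive := fun b _ => OSeq V₀ x b) p (fun {_} _ c ih => OSeq.snoc ih c) q

/-- Length of a sequence. -/
noncomputable def OSeq.len {x y : V₀} (p : OSeq V₀ x y) : ℕ :=
  OSeq.rec (motive := fun _ _ => ℕ) 0 (fun {_} _ _ ih => ih + 1) p

variable (k : Type) [Field k]
variable (Vf : V₀ → V₀ → Type) [∀ x y, AddCommGroup (Vf x y)] [∀ x y, Module k (Vf x y)]

/-- The space `W(u) = {}_{u_n}V_{u_{n-1}} ⊗ ⋯ ⊗ {}_{u_1}V_{u_0}` of a sequence. -/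
noncomputable def Wspace {x : V₀} : ∀ {y : V₀}, OSeq V₀ x y → ModuleCat k :=
  fun {y} p =>
    OSeq.rec (motive := fun _ _ => ModuleCat k)
      (ModuleCat.of k k)
      (fun {b} _ c ih => ModuleCat.of k (↥ih ⊗[k] Vf b c))
      p

/-- The morphism space `{}_y[L_k(V)]_x = ⊕_u W(u)` of the free `k`-category. -/
noncomputable abbrev HomSpace (x y : V₀) : Type := ⨁ u : OSeq V₀ x y, ↥(Wspace k Vf u)

/-- Composition (tensoring) `W(v) ⊗ W(u) → W(u⬝v)` on summands. -/
noncomputable def mulW {x y : V₀} (u : OSeq V₀ x y) : ∀ {z : V₀} (v : OSeq V₀ y z),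
    ↥(Wspace k Vf v) →ₗ[k] ↥(Wspace k Vf u) →ₗ[k] ↥(Wspace k Vf (u.comp v)) :=
  fun {z} v =>
    OSeq.rec (motive := fun b v' =>
        ↥(Wspace k Vf v') →ₗ[k] ↥(Wspace k Vf u) →ₗ[k] ↥(Wspace k Vf (u.comp v')))
      (LinearMap.lsmul k ↥(Wspace k Vf u))
      (fun {b} _ c ih => ((LinearMap.rTensorHom (Vf b c)).comp ih.flip).flip)
      v

end FreeLinearCategory

section Invariants

variable (k : Type) [Field k] {G : Type} [Group G] {V₀ : Type}
variable (Vf : V₀ → V₀ → Type) [∀ x y, AddCommGroup (Vf x y)] [∀ x y, Module k (Vf x y)]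
variable (ρ : ∀ x y : V₀, Representation k G (Vf x y))

/-- The diagonal action of `g : G` on `W(u) = V_γ`. -/
noncomputable def Wact (g : G) {x : V₀} : ∀ {y : V₀} (u : OSeq V₀ x y),
    ↥(Wspace k Vf u) →ₗ[k] ↥(Wspace k Vf u) :=
  fun {y} u =>
    OSeq.rec (motive := fun b u' => ↥(Wspace k Vf u') →ₗ[k] ↥(Wspace k Vf u'))
      LinearMap.id
      (fun {b} _ c ih => TensorProduct.map ih (ρ b c g))
      u

/-- The invariants `V_γ^G`. -/
noncomputable def WInv {x y : V₀} (u : OSeq V₀ x y) : Submodule k ↥(Wspace k Vf u) :=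
  ⨅ g : G, LinearMap.eqLocus (Wact k Vf ρ g u) LinearMap.id

/-- The composite invariants `[V_γ^G]²`: the span of products of invariants of the
two substrings of the proper factorizations of `γ`. -/
noncomputable def WComp {x y : V₀} (u : OSeq V₀ x y) : Submodule k ↥(Wspace k Vf u) :=
  Submodule.span k {w | ∃ (y' : V₀) (u₁ : OSeq V₀ x y') (u₂ : OSeq V₀ y' y)
    (h : u₁.comp u₂ = u), 0 < u₁.len ∧ 0 < u₂.len ∧
    ∃ a ∈ WInv k Vf ρ u₂, ∃ b ∈ WInv k Vf ρ u₁,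
      w = (show ↥(Wspace k Vf u) from h ▸ (mulW k Vf u₁ u₂ a b))}

/-- Factorizations of sequences into pieces of positive length: the morphisms of the
bases of the free category `L_k(U)` on the irreducible invariants. -/
inductive FactChain (V₀ : Type) : V₀ → V₀ → Type
  | nil (x : V₀) : FactChain V₀ x x
  | cons {x y z : V₀} (c : FactChain V₀ x y) (u : OSeq V₀ y z) (hu : 0 < u.len) :
      FactChain V₀ x z

/-- The underlying sequence of a factorization. -/
noncomputable def composeFact {x : V₀} : ∀ {y : V₀}, FactChain V₀ x y → OSeq V₀ x y :=
  fun {y} c =>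
    FactChain.rec (motive := fun b _ => OSeq V₀ x b)
      (OSeq.nil x) (fun {_ _} _ u _ ih => ih.comp u) c

variable (Irr : ∀ (x y : V₀) (u : OSeq V₀ x y), Submodule k ↥(Wspace k Vf u))

/-- The tensor product `[V_{β_l}^G]_irr ⊗ ⋯ ⊗ [V_{β_1}^G]_irr` along a
factorization: a summand of a morphism space of `L_k(U)`. -/
noncomputable def TFact {x : V₀} : ∀ {y : V₀}, FactChain V₀ x y → ModuleCat k :=
  fun {y} c =>
    FactChain.rec (motive := fun _ _ => ModuleCat k)
      (ModuleCat.of k k)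
      (fun {_ b'} _ u _ ih => ModuleCat.of k (↥ih ⊗[k] ↥(Irr _ b' u)))
      c

/-- The multiplication map `T(β) → W(γ)` for a factorization `β` of `γ`: the
morphism-space component of the canonical functor `F : L_k(U) → L_k(V)^G`. -/
noncomputable def iotaFact {x : V₀} : ∀ {y : V₀} (c : FactChain V₀ x y),
    ↥(TFact k Vf Irr c) →ₗ[k] ↥(Wspace k Vf (composeFact c)) :=
  fun {y} c =>
    FactChain.rec
      (motive := fun b c' => ↥(TFact k Vf Irr c') →ₗ[k] ↥(Wspace k Vf (composeFact c')))
      LinearMap.id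
      (fun {a b} c' u _ ih =>
        TensorProduct.lift
          ((((mulW k Vf (composeFact c') u).comp (Irr a b u).subtype).flip).comp ih))
      c

/-- The morphism-space map of the functor `F : L_k(U) → L_k(V)^G ⊆ L_k(V)`. -/
noncomputable def Fmap (x y : V₀) :
    (⨁ c : FactChain V₀ x y, ↥(TFact k Vf Irr c)) →ₗ[k] HomSpace k Vf x y :=
  DirectSum.toModule k _ _ fun c =>
    (DirectSum.lof k (OSeq V₀ x y) (fun u => ↥(Wspace k Vf u)) (composeFact c)).comp
      (iotaFact k Vf Irr c)

/-- The morphism space `{}_y[L_k(V)^G]_x = ⊕_γ V_γ^G` inside `{}_y[L_k(V)]_x`. -/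
noncomputable def InvHom (x y : V₀) : Submodule k (HomSpace k Vf x y) :=
  ⨆ u : OSeq V₀ x y,
    (WInv k Vf ρ u).map (DirectSum.lof k (OSeq V₀ x y) (fun u' => ↥(Wspace k Vf u')) u)

end Invariants

section FreeAlgebraWords

variable {k I P J : Type} [Field k]

/-- The linear map reading off the left cofactor of a letter `i`. -/
noncomputable def leftQuot (i : I) :
    MonoidAlgebra k (FreeMonoid I) →ₗ[k] MonoidAlgebra k (FreeMonoid I) :=
  (MonoidAlgebra.coeffLinearEquiv k).symm.toLinearMap ∘ₗ
    Finsupp.lcomapDomain (fun w => FreeMonoid.of i * w) (mul_right_injective _) ∘ₗ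
    (MonoidAlgebra.coeffLinearEquiv k).toLinearMap

lemma coeff_leftQuot (i : I) (t : MonoidAlgebra k (FreeMonoid I)) (w : FreeMonoid I) :
    (leftQuot i t).coeff w = t.coeff (FreeMonoid.of i * w) := rfl

lemma leftQuot_of_mul (i j : I) (s : MonoidAlgebra k (FreeMonoid I)) :
    leftQuot i (MonoidAlgebra.single (FreeMonoid.of j) 1 * s) = if i = j then s else 0 := by
  ext w
  rw [coeff_leftQuot]
  split_ifs with h
  · subst h
    rw [MonoidAlgebra.coeff_single_mul_eq_mul_coeff w (by simp), one_mul]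
  · rw [MonoidAlgebra.coeff_single_mul_of_forall_mul_ne]
    · simp
    · intro v hv
      exact h (List.cons.inj hv).1.symm

lemma leftQuot_mul (i : I) (t s : MonoidAlgebra k (FreeMonoid I)) :
    leftQuot i (t * s) = leftQuot i t * s + t.coeff 1 • leftQuot i s := by
  induction t using MonoidAlgebra.induction_linear with
  | zero => simp
  | add f g hf hg => simp only [add_mul, map_add, hf, hg, MonoidAlgebra.coeff_add,
      Finsupp.add_apply, add_smul]; abel
  | single w a =>
    induction w using FreeMonoid.casesOn with
    | one =>
      have h0 : leftQuot i (MonoidAlgebra.single (1 : FreeMonoid I) a) = 0 := by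
        ext w
        rw [coeff_leftQuot, MonoidAlgebra.coeff_single, Finsupp.single_apply, if_neg]
        · rfl
        · exact fun h => by cases h
      have h1 : MonoidAlgebra.single (1 : FreeMonoid I) a = a • 1 := by
        simp [MonoidAlgebra.one_def]
      rw [h0, h1, zero_mul, zero_add, smul_mul_assoc, one_mul, map_smul]
      simp [MonoidAlgebra.one_def]
    | of_mul j w =>
      have h1 : MonoidAlgebra.single (FreeMonoid.of j * w) a
          = MonoidAlgebra.single (FreeMonoid.of j) 1 * MonoidAlgebra.single w a := by
        simp [MonoidAlgebra.single_mul_single]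
      have h2 : (MonoidAlgebra.single (FreeMonoid.of j * w) a).coeff 1 = 0 := by
        rw [MonoidAlgebra.coeff_single, Finsupp.single_apply, if_neg]
        exact fun h => by cases h
      rw [h2, h1, mul_assoc, leftQuot_of_mul, leftQuot_of_mul]
      split_ifs <;> simp

lemma eq_zero_of_leftQuot {t : MonoidAlgebra k (FreeMonoid I)} (h1 : t.coeff 1 = 0)
    (h : ∀ i, leftQuot i t = 0) : t = 0 := by
  ext w
  induction w using FreeMonoid.casesOn with
  | one => simpa using h1
  | of_mul i w =>
    rw [← coeff_leftQuot, h]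
    rfl

/-- The linear projection onto the span of the words in `S`. -/
noncomputable def restrictWords (S : Set (FreeMonoid I)) :
    MonoidAlgebra k (FreeMonoid I) →ₗ[k] MonoidAlgebra k (FreeMonoid I) where
  toFun t := .ofCoeff (t.coeff.filter (· ∈ S))
  map_add' s t := by simp [Finsupp.filter_add]
  map_smul' a t := by simp [Finsupp.filter_smul]

lemma coeff_restrictWords (S : Set (FreeMonoid I)) (t : MonoidAlgebra k (FreeMonoid I))
    (w : FreeMonoid I) : (restrictWords S t).coeff w = if w ∈ S then t.coeff w else 0 := by
  simp [restrictWords, Finsupp.filter_apply]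

variable (π : I → P)

/-- Combinations of words `w` whose image under `π`, followed by `d`, is `γ`. -/
noncomputable def gradedPart (γ d : FreeMonoid P) :
    Submodule k (MonoidAlgebra k (FreeMonoid I)) :=
  MonoidAlgebra.supported k k {w | FreeMonoid.map π w * d = γ}

variable {π}

lemma mem_gradedPart {γ d : FreeMonoid P} {t : MonoidAlgebra k (FreeMonoid I)} :
    t ∈ gradedPart π γ d ↔ ∀ w, t.coeff w ≠ 0 → FreeMonoid.map π w * d = γ := by
  simp only [gradedPart, MonoidAlgebra.mem_supported']
  exact forall_congr' fun w => by simp [not_imp_comm]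

lemma single_mem_gradedPart {γ d : FreeMonoid P} {w : FreeMonoid I} (a : k)
    (h : FreeMonoid.map π w * d = γ) : MonoidAlgebra.single w a ∈ gradedPart (k := k) π γ d := by
  rw [mem_gradedPart]
  intro v hv
  rw [MonoidAlgebra.coeff_single, Finsupp.single_apply] at hv
  split_ifs at hv with hw
  · rw [← hw, h]
  · exact absurd rfl hv

lemma mul_mem_gradedPart {γ d d' : FreeMonoid P} {s t : MonoidAlgebra k (FreeMonoid I)}
    (hs : s ∈ gradedPart π γ d) (ht : t ∈ gradedPart π d d') : s * t ∈ gradedPart π γ d' := by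
  rw [mem_gradedPart] at *
  intro w hw
  obtain ⟨u, hu, v, hv, rfl⟩ :=
    Finset.mem_mul.1 (MonoidAlgebra.support_coeff_mul_subset s t (Finsupp.mem_support_iff.2 hw))
  rw [map_mul, mul_assoc, ht v (Finsupp.mem_support_iff.1 hv),
    hs u (Finsupp.mem_support_iff.1 hu)]

lemma mem_gradedPart_self_mul {γ d : FreeMonoid P} {t : MonoidAlgebra k (FreeMonoid I)} :
    t ∈ gradedPart π (γ * d) d ↔ t ∈ gradedPart π γ 1 := by
  simp [mem_gradedPart]

lemma restrictWords_mul {d : FreeMonoid P} {b : MonoidAlgebra k (FreeMonoid I)}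
    (hb : b ∈ gradedPart π d 1) (γ : FreeMonoid P) (t : MonoidAlgebra k (FreeMonoid I)) :
    restrictWords {w | FreeMonoid.map π w * 1 = γ} (t * b)
      = restrictWords {w | FreeMonoid.map π w * d = γ} t * b := by
  induction t using MonoidAlgebra.induction_linear with
  | zero => simp
  | add f g hf hg => simp only [add_mul, map_add, hf, hg]
  | single w a =>
    have hm : MonoidAlgebra.single w a * b ∈ gradedPart π (FreeMonoid.map π w * d) 1 :=
      mul_mem_gradedPart (single_mem_gradedPart a rfl) hb
    rw [mem_gradedPart] at hm
    by_cases h : FreeMonoid.map π w * d = γ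
    · have h1 : restrictWords {w | FreeMonoid.map π w * d = γ} (MonoidAlgebra.single w a)
          = MonoidAlgebra.single w a := by
        ext v
        rw [coeff_restrictWords]
        split_ifs with hv
        · rfl
        · rw [MonoidAlgebra.coeff_single, Finsupp.single_apply, if_neg]
          rintro rfl
          exact hv h
      rw [h1]
      ext v
      rw [coeff_restrictWords]
      split_ifs with hv
      · rfl
      · by_contra hc
        exact hv ((hm v (Ne.symm hc)).trans h)
    · have h1 : restrictWords {w | FreeMonoid.map π w * d = γ} (MonoidAlgebra.single w a)
          = 0 := by
        ext v
        rw [coeff_restrictWords]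
        split_ifs with hv
        · rw [MonoidAlgebra.coeff_single, Finsupp.single_apply, if_neg]
          · rfl
          rintro rfl
          exact h hv
        · rfl
      rw [h1, zero_mul]
      ext v
      rw [coeff_restrictWords]
      split_ifs with hv
      · by_contra hc
        exact h ((hm v hc).symm.trans hv)
      · rfl

variable {β : J → MonoidAlgebra k (FreeMonoid I)} {d : J → FreeMonoid P}

lemma linearCombination_mapRange
    (f : MonoidAlgebra k (FreeMonoid I) →ₗ[k] MonoidAlgebra k (FreeMonoid I))
    (t : J →₀ MonoidAlgebra k (FreeMonoid I)) :
    Finsupp.linearCombination (MonoidAlgebra k (FreeMonoid I)) β (t.mapRange f (map_zero f))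
      = t.sum fun j a => f a * β j := by
  rw [Finsupp.linearCombination_apply, Finsupp.sum_mapRange_index (by simp)]
  rfl

lemma eq_zero_of_relation_of_coeff_one (a : P) (γ : FreeMonoid P)
    (ih : ∀ t : J →₀ MonoidAlgebra k (FreeMonoid I), (∀ j, t j ∈ gradedPart π γ (d j)) →
      Finsupp.linearCombination _ β t = 0 → t = 0)
    (t : J →₀ MonoidAlgebra k (FreeMonoid I))
    (ht : ∀ j, t j ∈ gradedPart π (FreeMonoid.of a * γ) (d j)) (ht1 : ∀ j, (t j).coeff 1 = 0)
    (h : Finsupp.linearCombination _ β t = 0) : t = 0 := by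
  ext1 j
  refine eq_zero_of_leftQuot (ht1 j) fun i => ?_
  have key : t.mapRange (leftQuot i) (map_zero _) = 0 := by
    refine ih _ (fun j => ?_) ?_
    · rw [Finsupp.mapRange_apply, mem_gradedPart]
      intro w hw
      have := mem_gradedPart.1 (ht j) _ hw
      rw [map_mul, FreeMonoid.map_of, mul_assoc] at this
      exact (List.cons.inj this).2
    · rw [linearCombination_mapRange]
      have h2 := congrArg (leftQuot i) h
      rw [map_zero, Finsupp.linearCombination_apply, map_finsuppSum] at h2
      rw [← h2]
      refine Finsupp.sum_congr fun j _ => ?_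
      rw [smul_eq_mul, leftQuot_mul, ht1, zero_smul, add_zero]
  simpa using DFunLike.congr_fun key j

lemma eq_algebraMap_of_mem_gradedPart {γ : FreeMonoid P} {t : MonoidAlgebra k (FreeMonoid I)}
    (ht : t ∈ gradedPart π γ γ) : t = algebraMap k _ (t.coeff 1) := by
  ext w
  by_cases hw : w = 1
  · subst hw
    simp
  · have h0 : t.coeff w = 0 := by
      by_contra hc
      have := mem_gradedPart.1 ht w hc
      rw [mul_eq_right] at this
      exact hw (List.map_eq_nil_iff.1 this)
    rw [h0]
    simp [Ne.symm hw]

lemma coeff_one_eq_zero_of_mem_gradedPart {γ d : FreeMonoid P} (hd : d ≠ γ)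
    {t : MonoidAlgebra k (FreeMonoid I)} (ht : t ∈ gradedPart π γ d) : t.coeff 1 = 0 := by
  by_contra hc
  exact hd (by simpa using mem_gradedPart.1 ht 1 hc)

/-- A family of invariant homogeneous elements of positive degree in a free algebra is left
linearly independent as soon as its scalar combinations avoid the left combinations whose
coefficients are invariant of positive degree. -/
theorem linearIndependent_of_invariant_relations {G : Type}
    (hβ : ∀ j, β j ∈ gradedPart π (d j) 1) (hd : ∀ j, d j ≠ 1)
    (α : G → MonoidAlgebra k (FreeMonoid I) →ₐ[k] MonoidAlgebra k (FreeMonoid I))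
    (hα : ∀ g γ e, ∀ t ∈ gradedPart π γ e, α g t ∈ gradedPart π γ e)
    (hαβ : ∀ g j, α g (β j) = β j)
    (H : ∀ (γ : FreeMonoid P) (c : J →₀ k) (t : J →₀ MonoidAlgebra k (FreeMonoid I)),
      (∀ j, c j ≠ 0 → d j = γ) → (∀ g j, α g (t j) = t j) → (∀ j, (t j).coeff 1 = 0) →
      (∀ j, t j ∈ gradedPart π γ (d j)) →
      Finsupp.linearCombination k β c + Finsupp.linearCombination _ β t = 0 → c = 0) :
    LinearIndependent (MonoidAlgebra k (FreeMonoid I)) β := by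
  have homog : ∀ (γ : FreeMonoid P) (t : J →₀ MonoidAlgebra k (FreeMonoid I)),
      (∀ j, t j ∈ gradedPart π γ (d j)) → Finsupp.linearCombination _ β t = 0 → t = 0 := by
    intro γ
    induction γ using FreeMonoid.inductionOn' with
    | one =>
      intro t ht _
      ext j w
      by_contra hc
      refine hd j ?_
      have := congrArg FreeMonoid.length (mem_gradedPart.1 (ht j) w hc)
      rw [FreeMonoid.length_mul, FreeMonoid.length_one] at this
      exact FreeMonoid.length_eq_zero.1 (by omega)
    | of_mul a γ ih =>
      intro t ht h
      have pos := eq_zero_of_relation_of_coeff_one a γ ih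
      set c : J →₀ k := t.mapRange (fun s => s.coeff 1) (by simp) with hc
      set t' : J →₀ MonoidAlgebra k (FreeMonoid I) :=
        t - c.mapRange (algebraMap k _) (map_zero _) with ht'
      have hsum : Finsupp.linearCombination k β c
          + Finsupp.linearCombination (MonoidAlgebra k (FreeMonoid I)) β t' = 0 := by
        rw [ht', map_sub, h, zero_sub, Finsupp.linearCombination_apply,
          Finsupp.linearCombination_apply, Finsupp.sum_mapRange_index (by simp)]
        simp [Algebra.smul_def]
      have hcd : ∀ j, c j ≠ 0 → d j = FreeMonoid.of a * γ := by
        intro j hj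
        by_contra hne
        exact hj (coeff_one_eq_zero_of_mem_gradedPart hne (ht j))
      have hone : ∀ j, (t' j).coeff 1 = 0 := by
        intro j
        change (t j - algebraMap k _ ((t j).coeff 1)).coeff 1 = 0
        simp
      have hgr : ∀ j, t' j ∈ gradedPart π (FreeMonoid.of a * γ) (d j) := by
        intro j
        rw [ht', Finsupp.sub_apply]
        refine sub_mem (ht j) ?_
        rw [Finsupp.mapRange_apply]
        by_cases hj : c j = 0
        · rw [hj, map_zero]
          exact zero_mem _
        · exact single_mem_gradedPart _ (by simp [hcd j hj])
      have hinv : ∀ g j, α g (t' j) = t' j := by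
        intro g
        have hz : t'.mapRange (α g).toLinearMap (map_zero _) - t' = 0 := by
          refine pos _ (fun j => ?_) (fun j => ?_) ?_
          · rw [Finsupp.sub_apply, Finsupp.mapRange_apply]
            exact sub_mem (hα g _ _ _ (hgr j)) (hgr j)
          · rw [Finsupp.sub_apply, Finsupp.mapRange_apply]
            by_cases hj : d j = FreeMonoid.of a * γ
            · have h0 : t' j = 0 := by
                rw [eq_algebraMap_of_mem_gradedPart (γ := d j) (t := t' j)
                  (by simpa only [hj] using hgr j), hone, map_zero]
              simp [h0]
            · exact coeff_one_eq_zero_of_mem_gradedPart hj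
                (sub_mem (hα g _ _ _ (hgr j)) (hgr j))
          · rw [map_sub, linearCombination_mapRange]
            have e := congrArg (α g) hsum
            rw [map_add, map_zero, Finsupp.linearCombination_apply,
              Finsupp.linearCombination_apply, map_finsuppSum, map_finsuppSum] at e
            simp only [map_smul, smul_eq_mul, map_mul, hαβ] at e
            rw [← Finsupp.linearCombination_apply] at e
            rw [sub_eq_zero]
            exact add_left_cancel (e.trans hsum.symm)
        intro j
        simpa [sub_eq_zero] using DFunLike.congr_fun hz j
      have hc0 : c = 0 := H _ c t' hcd hinv hone hgr hsum
      have htt : t' = t := by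
        rw [ht', hc0]
        simp
      rw [hc0, map_zero, zero_add] at hsum
      rw [← htt]
      exact pos t' hgr hone hsum
  rw [linearIndependent_iff]
  intro t h
  have hz : ∀ γ j, restrictWords {w | FreeMonoid.map π w * d j = γ} (t j) = 0 := by
    intro γ
    set s : J →₀ MonoidAlgebra k (FreeMonoid I) :=
      Finsupp.onFinset t.support
        (fun j => restrictWords {w | FreeMonoid.map π w * d j = γ} (t j))
        (fun j hj => Finsupp.mem_support_iff.2 fun h0 => hj (by rw [h0, map_zero])) with hs
    have hs0 : s = 0 := by
      refine homog γ s (fun j => ?_) ?_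
      · rw [mem_gradedPart]
        intro w hw
        rw [hs, Finsupp.onFinset_apply, coeff_restrictWords] at hw
        by_contra hn
        exact hw (if_neg hn)
      · have e := congrArg (restrictWords {w | FreeMonoid.map π w * 1 = γ}) h
        rw [Finsupp.linearCombination_apply, map_finsuppSum, map_zero] at e
        simp only [smul_eq_mul, restrictWords_mul (hβ _)] at e
        rw [Finsupp.linearCombination_apply, hs, Finsupp.onFinset_sum _ (by simp)]
        exact e
    intro j
    exact DFunLike.congr_fun hs0 j
  ext j w
  have := congrArg (fun s => s.coeff w) (hz (FreeMonoid.map π w * d j) j)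
  simpa [coeff_restrictWords] using this

/-- Products along a list of letters. -/
noncomputable def wordProd (β : J → MonoidAlgebra k (FreeMonoid I)) :
    List J → MonoidAlgebra k (FreeMonoid I)
  | [] => 1
  | j :: l => wordProd β l * β j

lemma coeff_one_mul (s t : MonoidAlgebra k (FreeMonoid I)) (ht : t.coeff 1 = 0) :
    (s * t).coeff 1 = 0 := by
  by_contra hc
  obtain ⟨u, -, v, hv, huv⟩ :=
    Finset.mem_mul.1 (MonoidAlgebra.support_coeff_mul_subset s t (Finsupp.mem_support_iff.2 hc))
  have := congrArg FreeMonoid.length huv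
  rw [FreeMonoid.length_mul, FreeMonoid.length_one] at this
  obtain rfl : v = 1 := FreeMonoid.length_eq_zero.1 (by omega)
  exact Finsupp.mem_support_iff.1 hv ht

/-- Split a combination of lists according to their heads. -/
noncomputable def splitHead (β : J → MonoidAlgebra k (FreeMonoid I)) :
    (List J →₀ k) →ₗ[k] (J →₀ MonoidAlgebra k (FreeMonoid I)) :=
  Finsupp.linearCombination k fun l => match l with
    | [] => 0
    | j :: l => Finsupp.single j (wordProd β l)

lemma linearCombination_wordProd (f : List J →₀ k) :
    Finsupp.linearCombination k (wordProd β) f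
      = f [] • 1 + Finsupp.linearCombination _ β (splitHead β f) := by
  induction f using Finsupp.induction_linear with
  | zero => simp
  | add f g hf hg =>
    rw [map_add, hf, hg, map_add, map_add, Finsupp.add_apply, add_smul]
    abel
  | single l a =>
    rcases l with _ | ⟨j, l⟩
    · simp [splitHead, wordProd]
    · simp [splitHead, wordProd]

lemma splitHead_apply (f : List J →₀ k) (j : J) :
    splitHead β f j = Finsupp.linearCombination k (wordProd β)
      (Finsupp.lcomapDomain (R := k) (List.cons j) List.cons_injective f) := by
  induction f using Finsupp.induction_linear with
  | zero => simp
  | add f g hf hg => simp only [map_add, Finsupp.add_apply, hf, hg]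
  | single l a =>
    have key : ∀ m, (∀ l', m ≠ j :: l') →
        Finsupp.lcomapDomain (R := k) (List.cons j) List.cons_injective (Finsupp.single m a)
          = 0 := by
      intro m hm
      ext l'
      exact Finsupp.single_eq_of_ne (Ne.symm (hm l'))
    rcases l with _ | ⟨j', l⟩
    · rw [key _ (by simp)]
      simp [splitHead]
    · by_cases hj : j' = j
      · subst hj
        have : Finsupp.lcomapDomain (R := k) (List.cons j') List.cons_injective
            (Finsupp.single (j' :: l) a) = Finsupp.single l a := by
          ext l'
          change (Finsupp.single (j' :: l) a) (j' :: l') = _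
          simp [Finsupp.single_apply]
        rw [this]
        simp [splitHead]
      · rw [key _ (by simp [hj])]
        simp [splitHead, hj]

/-- A left linearly independent family without constant terms freely generates. -/
theorem linearIndependent_wordProd (h1 : ∀ j, (β j).coeff 1 = 0)
    (hβ : LinearIndependent (MonoidAlgebra k (FreeMonoid I)) β) :
    LinearIndependent k (wordProd β) := by
  rw [linearIndependent_iff]
  intro f hf
  ext l
  have hnil : ∀ f : List J →₀ k, Finsupp.linearCombination k (wordProd β) f = 0 → f [] = 0 := by
    intro f hf
    rw [linearCombination_wordProd] at hf
    have e := congrArg (fun s => s.coeff 1) hf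
    have hz : (Finsupp.linearCombination _ β (splitHead β f)).coeff 1 = 0 := by
      rw [Finsupp.linearCombination_apply, MonoidAlgebra.coeff_finsuppSum, Finsupp.sum_apply]
      exact Finset.sum_eq_zero fun j _ => coeff_one_mul _ _ (h1 j)
    simpa [MonoidAlgebra.one_def, hz] using e
  induction l generalizing f with
  | nil => exact hnil f hf
  | cons j l ih =>
    have hs : splitHead β f = 0 := by
      refine linearIndependent_iff.1 hβ _ ?_
      simpa [linearCombination_wordProd, hnil f hf] using hf
    exact ih (Finsupp.lcomapDomain (R := k) (List.cons j) List.cons_injective f)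
      (by rw [← splitHead_apply, hs, Finsupp.zero_apply])

end FreeAlgebraWords

section Sequences

variable {V₀ : Type}

/-- The list of arrows of a sequence. -/
noncomputable def OSeq.arrows {x : V₀} : ∀ {y : V₀}, OSeq V₀ x y → FreeMonoid (V₀ × V₀)
  | _, .nil _ => 1
  | _, .snoc (y := b) p c => p.arrows * FreeMonoid.of (b, c)

lemma OSeq.nil_comp {x y : V₀} (u : OSeq V₀ x y) : (OSeq.nil x).comp u = u := by
  induction u with
  | nil => rfl
  | snoc p z ih => exact congrArg (fun q => OSeq.snoc q z) ih

lemma OSeq.arrows_comp {x y z : V₀} (u : OSeq V₀ x y) (v : OSeq V₀ y z) :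
    (u.comp v).arrows = u.arrows * v.arrows := by
  induction v with
  | nil => exact (mul_one _).symm
  | snoc p z ih =>
    change (u.comp p).arrows * _ = u.arrows * (p.arrows * _)
    rw [ih, mul_assoc]

lemma OSeq.len_comp {x y z : V₀} (u : OSeq V₀ x y) (v : OSeq V₀ y z) :
    (u.comp v).len = u.len + v.len := by
  induction v with
  | nil => rfl
  | snoc p z ih => exact congrArg (· + 1) ih

lemma OSeq.length_arrows {x y : V₀} (u : OSeq V₀ x y) : u.arrows.length = u.len := by
  induction u with
  | nil => rfl
  | snoc p z ih =>
    change (p.arrows * _).length = p.len + 1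
    rw [FreeMonoid.length_mul, ih, FreeMonoid.length_of]

lemma FreeMonoid.mul_of_inj {P : Type} {u v : FreeMonoid P} {a b : P}
    (h : u * FreeMonoid.of a = v * FreeMonoid.of b) : u = v ∧ a = b := by
  have := List.append_inj' (s₁ := u.toList) (s₂ := v.toList) h rfl
  exact ⟨this.1, (List.cons.inj this.2).1⟩

lemma OSeq.exists_comp_eq {x a b : V₀} (q : OSeq V₀ a b) (u : OSeq V₀ x b)
    (l : FreeMonoid (V₀ × V₀)) (h : l * q.arrows = u.arrows) :
    ∃ p : OSeq V₀ x a, p.arrows = l ∧ p.comp q = u := by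
  induction q with
  | nil => exact ⟨u, by simpa [OSeq.arrows] using h.symm, rfl⟩
  | snoc q c ih =>
    cases u with
    | nil =>
      have := congrArg FreeMonoid.length h
      simp [OSeq.arrows] at this
    | snoc u c =>
      simp only [OSeq.arrows, ← mul_assoc] at h
      obtain ⟨h1, h2⟩ := FreeMonoid.mul_of_inj h
      obtain rfl := congrArg Prod.fst h2
      obtain ⟨p, hp, hpq⟩ := ih u h1
      exact ⟨p, hp, congrArg (fun r => OSeq.snoc r c) hpq⟩

lemma OSeq.target_eq {x y a b : V₀} (q : OSeq V₀ a b) (u : OSeq V₀ x y) (hq : 0 < q.len)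
    (l : FreeMonoid (V₀ × V₀)) (h : l * q.arrows = u.arrows) : b = y := by
  cases q with
  | nil => exact absurd hq (lt_irrefl 0)
  | snoc q c =>
    cases u with
    | nil =>
      have := congrArg FreeMonoid.length h
      simp [OSeq.arrows] at this
    | snoc u c' =>
      simp only [OSeq.arrows, ← mul_assoc] at h
      exact congrArg Prod.snd (FreeMonoid.mul_of_inj h).2

lemma OSeq.arrows_injective {x y : V₀} :
    Function.Injective (OSeq.arrows : OSeq V₀ x y → FreeMonoid (V₀ × V₀)) := by
  intro u v h
  obtain ⟨p, hp, hpu⟩ := OSeq.exists_comp_eq u v 1 (by rw [one_mul, h])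
  cases p with
  | nil => rw [← hpu, OSeq.nil_comp]
  | snoc p z =>
    have := congrArg FreeMonoid.length hp
    simp [OSeq.arrows] at this

/-- Sequences of positive length, with arbitrary end points. -/
abbrev PosSeq (V₀ : Type) : Type := {s : Σ a b : V₀, OSeq V₀ a b // 0 < s.2.2.len}

lemma PosSeq.arrows_injective :
    Function.Injective (fun s : PosSeq V₀ => s.1.2.2.arrows) := by
  rintro ⟨⟨a, b, q⟩, hq⟩ ⟨⟨x, y, u⟩, hu⟩ h
  dsimp only at h hq hu
  obtain rfl := OSeq.target_eq q u hq 1 (by rw [one_mul, h])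
  obtain ⟨p, hp, hpu⟩ := OSeq.exists_comp_eq q u 1 (by rw [one_mul, h])
  cases p with
  | nil =>
    rw [OSeq.nil_comp] at hpu
    subst hpu
    rfl
  | snoc p z =>
    have := congrArg FreeMonoid.length hp
    simp [OSeq.arrows] at this

/-- The list of pieces of a factorization, last piece first. -/
def FactChain.pieces {x : V₀} : ∀ {y : V₀}, FactChain V₀ x y → List (PosSeq V₀)
  | _, .nil _ => []
  | _, .cons c u hu => ⟨⟨_, _, u⟩, hu⟩ :: c.pieces

lemma FactChain.pieces_injective {x y : V₀} :
    Function.Injective (FactChain.pieces : FactChain V₀ x y → List (PosSeq V₀)) := by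
  intro c c' h
  induction c with
  | nil =>
    cases c' with
    | nil => rfl
    | cons c' u hu => simp [FactChain.pieces] at h
  | cons c u hu ih =>
    cases c' with
    | nil => simp [FactChain.pieces] at h
    | cons c' u' hu' =>
      simp only [FactChain.pieces, List.cons.injEq, Subtype.mk.injEq, Sigma.mk.injEq] at h
      obtain ⟨⟨rfl, h2⟩, h3⟩ := h
      simp only [heq_eq_eq, Sigma.mk.injEq, true_and] at h2
      subst h2
      rw [ih h3]

end Sequences

section WordModel

variable (k : Type) [Field k] {G : Type} [Group G] {V₀ : Type}
variable (Vf : V₀ → V₀ → Type) [∀ x y, AddCommGroup (Vf x y)] [∀ x y, Module k (Vf x y)]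
variable (ρ : ∀ x y : V₀, Representation k G (Vf x y))

/-- Basis vectors of all the spaces `Vf x y`. -/
abbrev Letter : Type := Σ p : V₀ × V₀, Module.Basis.ofVectorSpaceIndex k (Vf p.1 p.2)

/-- The free algebra on a basis of `⨁ Vf x y`. -/
abbrev WordAlg : Type := MonoidAlgebra k (FreeMonoid (Letter k Vf))

/-- The inclusion of `Vf b c` into the free algebra. -/
noncomputable def embLetter (b c : V₀) : Vf b c →ₗ[k] WordAlg k Vf :=
  (Module.Basis.ofVectorSpace k (Vf b c)).constr k
    fun i => MonoidAlgebra.single (FreeMonoid.of ⟨(b, c), i⟩) 1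

lemma embLetter_basis (b c : V₀) (i : Module.Basis.ofVectorSpaceIndex k (Vf b c)) :
    embLetter k Vf b c (Module.Basis.ofVectorSpace k (Vf b c) i)
      = MonoidAlgebra.single (FreeMonoid.of ⟨(b, c), i⟩) 1 :=
  Module.Basis.constr_basis _ _ _ _

/-- The homogeneous action of `g` on the free algebra. -/
noncomputable def wordAct (g : G) : WordAlg k Vf →ₐ[k] WordAlg k Vf :=
  MonoidAlgebra.lift k _ _ (FreeMonoid.lift fun i : Letter k Vf =>
    embLetter k Vf i.1.1 i.1.2
      (ρ i.1.1 i.1.2 g (Module.Basis.ofVectorSpace k (Vf i.1.1 i.1.2) i.2)))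

lemma wordAct_embLetter (g : G) (b c : V₀) (v : Vf b c) :
    wordAct k Vf ρ g (embLetter k Vf b c v) = embLetter k Vf b c (ρ b c g v) := by
  have : (wordAct k Vf ρ g).toLinearMap ∘ₗ embLetter k Vf b c
      = embLetter k Vf b c ∘ₗ ρ b c g := by
    refine (Module.Basis.ofVectorSpace k (Vf b c)).ext fun i => ?_
    rw [LinearMap.comp_apply, embLetter_basis]
    simp [wordAct]
  exact LinearMap.congr_fun this v

lemma embLetter_mem (b c : V₀) (v : Vf b c) :
    embLetter k Vf b c v ∈ gradedPart (k := k) (Sigma.fst : Letter k Vf → V₀ × V₀)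
      (FreeMonoid.of (b, c)) 1 := by
  have : (⊤ : Submodule k (Vf b c)) ≤ (gradedPart (k := k) (Sigma.fst : Letter k Vf → V₀ × V₀)
      (FreeMonoid.of (b, c)) 1).comap (embLetter k Vf b c) := by
    rw [← (Module.Basis.ofVectorSpace k (Vf b c)).span_eq, Submodule.span_le]
    rintro _ ⟨i, rfl⟩
    rw [SetLike.mem_coe, Submodule.mem_comap, embLetter_basis]
    exact single_mem_gradedPart _ rfl
  exact this Submodule.mem_top

lemma wordAct_mem (g : G) (γ e : FreeMonoid (V₀ × V₀)) (t : WordAlg k Vf)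
    (ht : t ∈ gradedPart (k := k) (Sigma.fst : Letter k Vf → V₀ × V₀) γ e) :
    wordAct k Vf ρ g t ∈ gradedPart (k := k) (Sigma.fst : Letter k Vf → V₀ × V₀) γ e := by
  have hw : ∀ w : FreeMonoid (Letter k Vf), wordAct k Vf ρ g (MonoidAlgebra.single w 1) ∈
      gradedPart (k := k) (Sigma.fst : Letter k Vf → V₀ × V₀) (FreeMonoid.map Sigma.fst w) 1 := by
    intro w
    induction w using FreeMonoid.inductionOn' with
    | one =>
      have e : wordAct k Vf ρ g (MonoidAlgebra.single 1 1) = MonoidAlgebra.single 1 1 :=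
        map_one (wordAct k Vf ρ g)
      rw [e, mem_gradedPart]
      intro v hv
      rw [MonoidAlgebra.coeff_single, Finsupp.single_apply] at hv
      obtain rfl : 1 = v := by by_contra hc; exact hv (if_neg hc)
      exact mul_one _
    | of_mul i w ih =>
      have e : MonoidAlgebra.single (FreeMonoid.of i * w) (1 : k)
          = MonoidAlgebra.single (FreeMonoid.of i) 1 * MonoidAlgebra.single w 1 := by
        simp [MonoidAlgebra.single_mul_single]
      have hi := embLetter_basis k Vf i.1.1 i.1.2 i.2
      rw [e, map_mul (wordAct k Vf ρ g), ← hi, wordAct_embLetter, map_mul, FreeMonoid.map_of]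
      refine mul_mem_gradedPart (d := FreeMonoid.map Sigma.fst w) ?_ ih
      exact mem_gradedPart_self_mul.2 (embLetter_mem k Vf _ _ _)
  have hle : gradedPart (k := k) (Sigma.fst : Letter k Vf → V₀ × V₀) γ e ≤
      (gradedPart (k := k) (Sigma.fst : Letter k Vf → V₀ × V₀) γ e).comap
        (wordAct k Vf ρ g).toLinearMap := by
    conv_lhs => rw [gradedPart, MonoidAlgebra.supported_eq_span_single]
    rw [Submodule.span_le]
    rintro _ ⟨w, hγ, rfl⟩
    have := hw w
    rw [SetLike.mem_coe, Submodule.mem_comap]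
    rw [mem_gradedPart] at this ⊢
    intro v hv
    have hv' := this v hv
    rw [mul_one] at hv'
    rw [hv']
    exact hγ
  exact hle ht

/-- The embedding of `W(u)` into the free algebra. -/
noncomputable def toWords {x : V₀} : ∀ {y : V₀} (u : OSeq V₀ x y),
    ↥(Wspace k Vf u) →ₗ[k] WordAlg k Vf :=
  fun {_} u =>
    OSeq.rec (motive := fun _ u' => ↥(Wspace k Vf u') →ₗ[k] WordAlg k Vf)
      (Algebra.linearMap k (WordAlg k Vf))
      (fun {b} _ c ih => TensorProduct.lift ((LinearMap.mul k (WordAlg k Vf)).compl₁₂ ih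
        (embLetter k Vf b c)))
      u

lemma toWords_tmul {x b : V₀} (p : OSeq V₀ x b) (c : V₀) (a : ↥(Wspace k Vf p)) (v : Vf b c) :
    toWords k Vf (p.snoc c) (a ⊗ₜ[k] v : ↥(Wspace k Vf p) ⊗[k] Vf b c)
      = toWords k Vf p a * embLetter k Vf b c v := rfl

@[elab_as_elim]
lemma Wspace_snoc_induction {x b : V₀} (p : OSeq V₀ x b) (c : V₀)
    {C : ↥(Wspace k Vf (p.snoc c)) → Prop} (z : ↥(Wspace k Vf (p.snoc c)))
    (zero : C 0) (tmul : ∀ (a : ↥(Wspace k Vf p)) (v : Vf b c),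
      C (a ⊗ₜ[k] v : ↥(Wspace k Vf p) ⊗[k] Vf b c))
    (add : ∀ s t, C s → C t → C (s + t)) : C z :=
  TensorProduct.induction_on (motive := C) z zero tmul add

lemma toWords_mulW {x y z : V₀} (u : OSeq V₀ x y) (v : OSeq V₀ y z)
    (a : ↥(Wspace k Vf v)) (b : ↥(Wspace k Vf u)) :
    toWords k Vf (u.comp v) (mulW k Vf u v a b) = toWords k Vf u b * toWords k Vf v a := by
  induction v with
  | nil =>
    change toWords k Vf u ((show k from a) • b) = toWords k Vf u b * algebraMap k _ (show k from a)
    rw [map_smul, ← Algebra.commutes, Algebra.smul_def]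
  | snoc p c ih =>
    induction a using Wspace_snoc_induction with
    | zero => simp
    | tmul a v =>
      change toWords k Vf ((u.comp p).snoc c)
        (mulW k Vf u p a b ⊗ₜ[k] v : ↥(Wspace k Vf (u.comp p)) ⊗[k] _) = _
      rw [toWords_tmul, toWords_tmul, ih, mul_assoc]
    | add s t hs ht => rw [map_add, LinearMap.add_apply, map_add, hs, ht, map_add, mul_add]

lemma toWords_Wact (g : G) {x y : V₀} (u : OSeq V₀ x y) (a : ↥(Wspace k Vf u)) :
    toWords k Vf u (Wact k Vf ρ g u a) = wordAct k Vf ρ g (toWords k Vf u a) := by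
  induction u with
  | nil => exact ((wordAct k Vf ρ g).commutes _).symm
  | snoc p c ih =>
    induction a using Wspace_snoc_induction with
    | zero => simp
    | tmul a v =>
      change toWords k Vf (p.snoc c)
        (Wact k Vf ρ g p a ⊗ₜ[k] ρ _ c g v : ↥(Wspace k Vf p) ⊗[k] _) = _
      rw [toWords_tmul, toWords_tmul, ih, map_mul, wordAct_embLetter]
    | add s t hs ht => simp only [map_add, hs, ht]

lemma toWords_mem {x y : V₀} (u : OSeq V₀ x y) (a : ↥(Wspace k Vf u)) :
    toWords k Vf u a ∈ gradedPart (k := k) (Sigma.fst : Letter k Vf → V₀ × V₀) u.arrows 1 := by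
  induction u with
  | nil => exact single_mem_gradedPart _ rfl
  | snoc p c ih =>
    induction a using Wspace_snoc_induction with
    | zero => simp
    | tmul a v =>
      rw [toWords_tmul]
      exact mul_mem_gradedPart (mem_gradedPart_self_mul.2 (ih a)) (embLetter_mem k Vf _ _ _)
    | add s t hs ht =>
      rw [map_add]
      exact add_mem hs ht

lemma exists_word_basis {x y : V₀} (u : OSeq V₀ x y) :
    ∃ (ι : Type) (B : Module.Basis ι k ↥(Wspace k Vf u)) (w : ι → FreeMonoid (Letter k Vf)),
      Function.Injective w ∧ (∀ i, toWords k Vf u (B i) = MonoidAlgebra.single (w i) 1) ∧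
      ∀ v, FreeMonoid.map Sigma.fst v = u.arrows → v ∈ Set.range w := by
  induction u with
  | nil =>
    refine ⟨Unit, (Module.Basis.singleton Unit k : Module.Basis Unit k k), fun _ => 1,
      fun _ _ _ => rfl, fun i => ?_, fun v hv => ⟨(), ?_⟩⟩
    · exact (congrArg (algebraMap k (WordAlg k Vf))
        (Module.Basis.singleton_apply Unit k i)).trans (map_one _)
    · exact (List.map_eq_nil_iff.1 hv).symm
  | @snoc b p c ih =>
    obtain ⟨ι, B, w, hw, hB, hr⟩ := ih
    refine ⟨ι × Module.Basis.ofVectorSpaceIndex k (Vf b c),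
      (B.tensorProduct (Module.Basis.ofVectorSpace k (Vf b c)) :
        Module.Basis _ k (↥(Wspace k Vf p) ⊗[k] Vf b c)),
      fun i => w i.1 * FreeMonoid.of ⟨(b, c), i.2⟩, ?_, ?_, ?_⟩
    · rintro ⟨i, s⟩ ⟨j, t⟩ h
      obtain ⟨h1, h2⟩ := FreeMonoid.mul_of_inj h
      obtain rfl := hw h1
      obtain rfl : s = t := by simpa using h2
      rfl
    · rintro ⟨i, s⟩
      refine (congrArg (toWords k Vf (p.snoc c)) (Module.Basis.tensorProduct_apply B
        (Module.Basis.ofVectorSpace k (Vf b c)) i s)).trans ?_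
      exact (toWords_tmul k Vf p c _ _).trans
        (by rw [hB, embLetter_basis, MonoidAlgebra.single_mul_single, one_mul])
    · intro v hv
      obtain ⟨v1, v2, rfl, hv1, hv2⟩ :=
        List.map_eq_append_iff (f := Sigma.fst) (l := v) (L₁ := p.arrows) (L₂ := [(b, c)]).1 hv
      obtain ⟨i, rfl⟩ := hr v1 hv1
      obtain ⟨⟨⟨b', c'⟩, s⟩, rfl, hs⟩ := List.map_eq_singleton_iff.1 hv2
      obtain ⟨rfl, rfl⟩ := Prod.mk.inj hs
      exact ⟨(i, s), rfl⟩

lemma toWords_injective {x y : V₀} (u : OSeq V₀ x y) :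
    Function.Injective (toWords k Vf u) := by
  obtain ⟨ι, B, w, hw, hB, -⟩ := exists_word_basis k Vf u
  refine LinearMap.injective_of_linearIndependent B.span_eq ?_
  have : toWords k Vf u ∘ B = (MonoidAlgebra.basis (FreeMonoid (Letter k Vf)) k) ∘ w := by
    ext1 i
    exact hB i
  rw [this]
  exact (Module.Basis.linearIndependent _).comp w hw

lemma mem_range_toWords {x y : V₀} (u : OSeq V₀ x y) {t : WordAlg k Vf}
    (ht : t ∈ gradedPart (k := k) (Sigma.fst : Letter k Vf → V₀ × V₀) u.arrows 1) :
    ∃ a, toWords k Vf u a = t := by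
  obtain ⟨ι, B, w, -, hB, hr⟩ := exists_word_basis k Vf u
  have hle : gradedPart (k := k) (Sigma.fst : Letter k Vf → V₀ × V₀) u.arrows 1 ≤
      LinearMap.range (toWords k Vf u) := by
    rw [gradedPart, MonoidAlgebra.supported_eq_span_single, Submodule.span_le]
    rintro _ ⟨v, hv, rfl⟩
    obtain ⟨i, rfl⟩ := hr v (by simpa using hv)
    exact ⟨B i, hB i⟩
  exact hle ht

variable {k Vf ρ} in
lemma mem_WInv_iff {x y : V₀} {u : OSeq V₀ x y} {a : ↥(Wspace k Vf u)} :
    a ∈ WInv k Vf ρ u ↔ ∀ g, wordAct k Vf ρ g (toWords k Vf u a) = toWords k Vf u a := by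
  simp only [WInv, Submodule.mem_iInf, LinearMap.mem_eqLocus, LinearMap.id_apply]
  refine forall_congr' fun g => ?_
  rw [← toWords_Wact]
  exact (toWords_injective k Vf u).eq_iff.symm

/-- The embedding of a morphism space into the free algebra. -/
noncomputable def homToWords (x y : V₀) : HomSpace k Vf x y →ₗ[k] WordAlg k Vf :=
  DirectSum.toModule k _ _ fun u => toWords k Vf u

lemma homToWords_lof {x y : V₀} (u : OSeq V₀ x y) (a : ↥(Wspace k Vf u)) :
    homToWords k Vf x y
      (DirectSum.lof k (OSeq V₀ x y) (fun u => ↥(Wspace k Vf u)) u a) = toWords k Vf u a :=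
  DirectSum.toModule_lof _ _ _

lemma restrictWords_homToWords {x y : V₀} (u : OSeq V₀ x y) (h : HomSpace k Vf x y) :
    restrictWords {w | FreeMonoid.map Sigma.fst w = u.arrows} (homToWords k Vf x y h)
      = toWords k Vf u (h u) := by
  induction h using DirectSum.induction_on with
  | zero => simp
  | add s t hs ht => rw [map_add, map_add, hs, ht, DirectSum.add_apply, map_add]
  | of v a =>
    rw [← DirectSum.lof_eq_of k, homToWords_lof]
    have hm := mem_gradedPart.1 (toWords_mem k Vf v a)
    ext w
    rw [coeff_restrictWords]
    by_cases hv : v = u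
    · subst hv
      rw [DirectSum.lof_apply]
      split_ifs with hw
      · rfl
      · by_contra hc
        exact hw (by simpa using hm w (Ne.symm hc))
    · rw [DirectSum.lof_eq_of, DirectSum.of_eq_of_ne _ _ _ (Ne.symm hv), map_zero]
      split_ifs with hw
      · by_contra hc
        refine hv (OSeq.arrows_injective ?_)
        rw [← hm w hc, mul_one]
        exact hw
      · rfl

lemma homToWords_injective (x y : V₀) : Function.Injective (homToWords k Vf x y) := by
  refine (injective_iff_map_eq_zero _).2 fun h hh => ?_
  refine DFinsupp.ext fun u => toWords_injective k Vf u ?_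
  rw [← restrictWords_homToWords, hh, map_zero]
  exact (map_zero _).symm

end WordModel

section InvariantCategory

variable (k : Type) [Field k] {G : Type} [Group G] {V₀ : Type}
variable (Vf : V₀ → V₀ → Type) [∀ x y, AddCommGroup (Vf x y)] [∀ x y, Module k (Vf x y)]
variable (ρ : ∀ x y : V₀, Representation k G (Vf x y))
variable (Irr : ∀ (x y : V₀) (u : OSeq V₀ x y), Submodule k ↥(Wspace k Vf u))

variable {k Vf ρ} in
lemma exists_mem_WComp {x y a b : V₀} (u : OSeq V₀ x y) (q : OSeq V₀ a b) (hq : 0 < q.len)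
    {t : WordAlg k Vf}
    (ht : t ∈ gradedPart (k := k) (Sigma.fst : Letter k Vf → V₀ × V₀) u.arrows q.arrows)
    (h1 : t.coeff 1 = 0) (hinv : ∀ g, wordAct k Vf ρ g t = t)
    {s : ↥(Wspace k Vf q)} (hs : s ∈ WInv k Vf ρ q) :
    ∃ z ∈ WComp k Vf ρ u, toWords k Vf u z = t * toWords k Vf q s := by
  by_cases h0 : t = 0
  · exact ⟨0, zero_mem _, by rw [h0, zero_mul, map_zero]⟩
  obtain ⟨w, hw⟩ : ∃ w, t.coeff w ≠ 0 := by
    by_contra! hc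
    exact h0 (MonoidAlgebra.ext (Finsupp.ext hc))
  have hwq := mem_gradedPart.1 ht w hw
  obtain rfl := OSeq.target_eq q u hq _ hwq
  obtain ⟨p, hp, rfl⟩ := OSeq.exists_comp_eq q u _ hwq
  have hp0 : 0 < p.len := by
    rw [← OSeq.length_arrows, hp, Nat.pos_iff_ne_zero]
    intro hl
    have hw1 : w = 1 := List.map_eq_nil_iff.1 (FreeMonoid.length_eq_zero.1 hl)
    exact hw (hw1 ▸ h1)
  rw [OSeq.arrows_comp, mem_gradedPart_self_mul] at ht
  obtain ⟨t₀, rfl⟩ := mem_range_toWords k Vf p ht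
  exact ⟨mulW k Vf p q s t₀, Submodule.subset_span
    ⟨_, p, q, rfl, hp0, hq, s, hs, t₀, mem_WInv_iff.2 hinv, rfl⟩, toWords_mulW k Vf p q s t₀⟩

/-- Basis vectors of all the chosen spaces of irreducible invariants. -/
abbrev IrrIndex : Type :=
  Σ s : PosSeq V₀, Module.Basis.ofVectorSpaceIndex k ↥(Irr s.1.1 s.1.2.1 s.1.2.2)

/-- The basis vectors of the irreducible invariants inside the free algebra. -/
noncomputable def irrWord (j : IrrIndex k Vf Irr) : WordAlg k Vf :=
  toWords k Vf j.1.1.2.2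
    (Module.Basis.ofVectorSpace k ↥(Irr j.1.1.1 j.1.1.2.1 j.1.1.2.2) j.2).1

variable {k Vf Irr}

lemma irrWord_mem (j : IrrIndex k Vf Irr) :
    irrWord k Vf Irr j ∈ gradedPart (k := k) (Sigma.fst : Letter k Vf → V₀ × V₀)
      j.1.1.2.2.arrows 1 :=
  toWords_mem k Vf _ _

lemma PosSeq.arrows_ne_one (s : PosSeq V₀) : s.1.2.2.arrows ≠ 1 := by
  intro h
  have := OSeq.length_arrows s.1.2.2
  rw [h, FreeMonoid.length_one] at this
  exact s.2.ne this

lemma linearIndependent_irrWord_mk (s : PosSeq V₀) :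
    LinearIndependent k fun i => irrWord k Vf Irr ⟨s, i⟩ :=
  (Module.Basis.ofVectorSpace k ↥(Irr s.1.1 s.1.2.1 s.1.2.2)).linearIndependent.map'
    (toWords k Vf s.1.2.2 ∘ₗ (Irr s.1.1 s.1.2.1 s.1.2.2).subtype)
    (LinearMap.ker_eq_bot.2 ((toWords_injective k Vf _).comp Subtype.val_injective))

variable {ρ}

lemma linearIndependent_irrWord
    (hIrr : ∀ (x y : V₀) (u : OSeq V₀ x y), 0 < u.len →
      Irr x y u ⊓ WComp k Vf ρ u = ⊥ ∧ Irr x y u ⊔ WComp k Vf ρ u = WInv k Vf ρ u) :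
    LinearIndependent (WordAlg k Vf) (irrWord k Vf Irr) := by
  have hinv : ∀ j : IrrIndex k Vf Irr,
      (Module.Basis.ofVectorSpace k ↥(Irr j.1.1.1 j.1.1.2.1 j.1.1.2.2) j.2).1
        ∈ WInv k Vf ρ j.1.1.2.2 := fun j => by
    rw [← (hIrr _ _ _ j.1.2).2]
    exact Submodule.mem_sup_left (Subtype.mem _)
  refine linearIndependent_of_invariant_relations (π := Sigma.fst)
    (d := fun j => j.1.1.2.2.arrows) irrWord_mem (fun j => j.1.arrows_ne_one)
    (wordAct k Vf ρ) (wordAct_mem k Vf ρ) (fun g j => mem_WInv_iff.1 (hinv j) g) ?_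
  intro γ c t hc ht ht1 htγ hsum
  by_contra hne
  obtain ⟨⟨s, i⟩, hi⟩ := Finsupp.ne_iff.1 hne
  obtain rfl := hc ⟨s, i⟩ hi
  have hs : ∀ j, c j ≠ 0 → j.1 = s := fun j hj =>
    PosSeq.arrows_injective (hc j hj)
  obtain ⟨a, ha, hca⟩ : Finsupp.linearCombination k (irrWord k Vf Irr) c
      ∈ (Irr _ _ s.1.2.2).map (toWords k Vf s.1.2.2) := by
    rw [Finsupp.linearCombination_apply]
    refine Submodule.sum_mem _ fun j hj => Submodule.smul_mem _ _ ?_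
    obtain ⟨s', i'⟩ := j
    obtain rfl : s' = s := hs _ (Finsupp.mem_support_iff.1 hj)
    exact Submodule.mem_map_of_mem (Subtype.mem _)
  obtain ⟨z, hz, htz⟩ : Finsupp.linearCombination _ (irrWord k Vf Irr) t
      ∈ (WComp k Vf ρ s.1.2.2).map (toWords k Vf s.1.2.2) := by
    rw [Finsupp.linearCombination_apply]
    refine Submodule.sum_mem _ fun j _ => ?_
    exact exists_mem_WComp _ _ j.1.2 (htγ j) (ht1 j) (fun g => ht g j) (hinv j)
  have haz : a = -z := toWords_injective k Vf s.1.2.2 <| by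
    rw [map_neg, hca, htz]
    exact eq_neg_of_add_eq_zero_left hsum
  have ha0 : a = 0 := by
    rw [← Submodule.mem_bot k, ← (hIrr _ _ _ s.2).1]
    exact ⟨ha, haz ▸ neg_mem hz⟩
  rw [ha0, map_zero] at hca
  have hcd : (c.comapDomain (Sigma.mk s) sigma_mk_injective.injOn).mapDomain (Sigma.mk s) = c := by
    refine Finsupp.mapDomain_comapDomain _ sigma_mk_injective c ?_
    rintro ⟨s', i'⟩ hj
    obtain rfl : s' = s := hs _ (Finsupp.mem_support_iff.1 hj)
    exact ⟨i', rfl⟩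
  rw [← hcd, Finsupp.linearCombination_mapDomain] at hca
  exact hi (DFunLike.congr_fun
    (linearIndependent_iff.1 (linearIndependent_irrWord_mk s) _ hca.symm) i)

variable (k Vf Irr) in
/-- The summand of the free category on the irreducible invariants indexed by a factorization,
mapped to the free algebra. -/
noncomputable def chainWord {x y : V₀} (c : FactChain V₀ x y) :
    ↥(TFact k Vf Irr c) →ₗ[k] WordAlg k Vf :=
  toWords k Vf (composeFact c) ∘ₗ iotaFact k Vf Irr c

lemma chainWord_cons {x y z : V₀} (c : FactChain V₀ x y) (u : OSeq V₀ y z) (hu : 0 < u.len)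
    (a : ↥(TFact k Vf Irr c)) (b : ↥(Irr y z u)) :
    chainWord k Vf Irr (c.cons u hu) (a ⊗ₜ[k] b : ↥(TFact k Vf Irr c) ⊗[k] ↥(Irr y z u))
      = chainWord k Vf Irr c a * toWords k Vf u b :=
  toWords_mulW k Vf (composeFact c) u b (iotaFact k Vf Irr c a)

lemma homToWords_Fmap_lof {x y : V₀} (c : FactChain V₀ x y) (a : ↥(TFact k Vf Irr c)) :
    homToWords k Vf x y (Fmap k Vf Irr x y
      (DirectSum.lof k _ (fun c : FactChain V₀ x y => ↥(TFact k Vf Irr c)) c a))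
      = chainWord k Vf Irr c a := by
  rw [Fmap, DirectSum.toModule_lof, LinearMap.comp_apply, homToWords_lof]
  rfl

@[elab_as_elim]
lemma TFact_cons_induction {x y z : V₀} (c : FactChain V₀ x y) (u : OSeq V₀ y z)
    (hu : 0 < u.len) {C : ↥(TFact k Vf Irr (c.cons u hu)) → Prop}
    (t : ↥(TFact k Vf Irr (c.cons u hu)))
    (zero : C 0) (tmul : ∀ (a : ↥(TFact k Vf Irr c)) (b : ↥(Irr y z u)),
      C (a ⊗ₜ[k] b : ↥(TFact k Vf Irr c) ⊗[k] ↥(Irr y z u)))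
    (add : ∀ s t, C s → C t → C (s + t)) : C t :=
  TensorProduct.induction_on (motive := C) t zero tmul add

lemma exists_chain_basis {x y : V₀} (c : FactChain V₀ x y) :
    ∃ (ι : Type) (B : Module.Basis ι k ↥(TFact k Vf Irr c)) (l : ι → List (IrrIndex k Vf Irr)),
      Function.Injective l ∧
      (∀ i, chainWord k Vf Irr c (B i) = wordProd (irrWord k Vf Irr) (l i)) ∧
      ∀ i, (l i).map Sigma.fst = c.pieces := by
  induction c with
  | nil =>
    refine ⟨Unit, (Module.Basis.singleton Unit k : Module.Basis Unit k k), fun _ => [],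
      fun _ _ _ => rfl, fun i => ?_, fun _ => rfl⟩
    exact (congrArg (algebraMap k (WordAlg k Vf))
      (Module.Basis.singleton_apply Unit k i)).trans (map_one _)
  | @cons b z c u hu ih =>
    obtain ⟨ι, B, l, hl, hB, hp⟩ := ih
    refine ⟨ι × Module.Basis.ofVectorSpaceIndex k ↥(Irr b z u),
      (B.tensorProduct (Module.Basis.ofVectorSpace k ↥(Irr b z u)) :
        Module.Basis _ k (↥(TFact k Vf Irr c) ⊗[k] ↥(Irr b z u))),
      fun i => ⟨⟨⟨b, z, u⟩, hu⟩, i.2⟩ :: l i.1, ?_, ?_, ?_⟩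
    · rintro ⟨i, s⟩ ⟨j, t⟩ h
      obtain ⟨h1, h2⟩ := List.cons.inj h
      obtain rfl := hl h2
      obtain rfl : s = t := eq_of_heq (Sigma.mk.inj h1).2
      rfl
    · rintro ⟨i, s⟩
      refine (congrArg (chainWord k Vf Irr (c.cons u hu)) (Module.Basis.tensorProduct_apply B
        (Module.Basis.ofVectorSpace k ↥(Irr b z u)) i s)).trans ?_
      refine (chainWord_cons c u hu _ _).trans ?_
      rw [hB]
      rfl
    · rintro ⟨i, s⟩
      exact congrArg (List.cons _) (hp i)

lemma Fmap_injective
    (hIrr : ∀ (x y : V₀) (u : OSeq V₀ x y), 0 < u.len →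
      Irr x y u ⊓ WComp k Vf ρ u = ⊥ ∧ Irr x y u ⊔ WComp k Vf ρ u = WInv k Vf ρ u)
    (x y : V₀) : Function.Injective (Fmap k Vf Irr x y) := by
  have hli : LinearIndependent k (wordProd (irrWord k Vf Irr)) :=
    linearIndependent_wordProd (fun j => coeff_one_eq_zero_of_mem_gradedPart
      j.1.arrows_ne_one.symm (irrWord_mem j)) (linearIndependent_irrWord hIrr)
  choose ι B l hl hB hp using
    fun c : FactChain V₀ x y => exists_chain_basis (k := k) (Vf := Vf) (Irr := Irr) c
  let v : (Σ c, ι c) → ⨁ c : FactChain V₀ x y, ↥(TFact k Vf Irr c) := fun i =>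
    DirectSum.lof k _ (fun c : FactChain V₀ x y => ↥(TFact k Vf Irr c)) i.1 (B i.1 i.2)
  have hspan : Submodule.span k (Set.range v) = ⊤ := by
    refine eq_top_iff.2 fun f _ => ?_
    induction f using DirectSum.induction_on with
    | zero => exact zero_mem _
    | add s t hs ht => exact add_mem (hs trivial) (ht trivial)
    | of c t =>
      have : Submodule.span k (Set.range (B c)) ≤ (Submodule.span k (Set.range v)).comap
          (DirectSum.lof k _ (fun c : FactChain V₀ x y => ↥(TFact k Vf Irr c)) c) := by
        rw [Submodule.span_le]
        rintro _ ⟨i, rfl⟩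
        exact Submodule.subset_span ⟨⟨c, i⟩, rfl⟩
      rw [(B c).span_eq] at this
      exact this Submodule.mem_top
  have hinj : Function.Injective fun i : Σ c, ι c => l i.1 i.2 := by
    rintro ⟨c, i⟩ ⟨c', i'⟩ h
    dsimp only at h
    obtain rfl : c = c' := FactChain.pieces_injective <| by rw [← hp c i, ← hp c' i', h]
    rw [hl c h]
  have hcomp : (homToWords k Vf x y ∘ₗ Fmap k Vf Irr x y) ∘ v
      = wordProd (irrWord k Vf Irr) ∘ fun i : Σ c, ι c => l i.1 i.2 := by
    ext1 i
    exact (homToWords_Fmap_lof i.1 _).trans (hB i.1 i.2)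
  have : Function.Injective (homToWords k Vf x y ∘ Fmap k Vf Irr x y) :=
    LinearMap.injective_of_linearIndependent hspan (hcomp ▸ hli.comp _ hinj)
  exact Function.Injective.of_comp this

lemma iotaFact_mem_WInv
    (hIrr : ∀ (x y : V₀) (u : OSeq V₀ x y), 0 < u.len → Irr x y u ≤ WInv k Vf ρ u)
    {x y : V₀} (c : FactChain V₀ x y) (t : ↥(TFact k Vf Irr c)) :
    iotaFact k Vf Irr c t ∈ WInv k Vf ρ (composeFact c) := by
  rw [mem_WInv_iff]
  intro g
  change wordAct k Vf ρ g (chainWord k Vf Irr c t) = chainWord k Vf Irr c t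
  induction c with
  | nil => exact (wordAct k Vf ρ g).commutes _
  | @cons b z c u hu ih =>
    induction t using TFact_cons_induction with
    | zero => rw [map_zero, map_zero]
    | tmul a s => rw [chainWord_cons, map_mul, ih, mem_WInv_iff.1 (hIrr _ _ _ hu s.2)]
    | add s t hs ht => rw [map_add, map_add, hs, ht]

lemma range_Fmap_le
    (hIrr : ∀ (x y : V₀) (u : OSeq V₀ x y), 0 < u.len → Irr x y u ≤ WInv k Vf ρ u)
    (x y : V₀) : LinearMap.range (Fmap k Vf Irr x y) ≤ InvHom k Vf ρ x y := by
  rintro _ ⟨f, rfl⟩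
  induction f using DirectSum.induction_on with
  | zero => rw [map_zero]; exact zero_mem _
  | add s t hs ht => rw [map_add]; exact add_mem hs ht
  | of c t =>
    rw [← DirectSum.lof_eq_of k, Fmap, DirectSum.toModule_lof]
    exact Submodule.mem_iSup_of_mem (composeFact c)
      (Submodule.mem_map_of_mem (iotaFact_mem_WInv hIrr c t))

variable (k Vf Irr) in
/-- The image of a morphism space of the free category on the irreducible invariants in the
free algebra. -/
noncomputable def wordRange (x y : V₀) : Submodule k (WordAlg k Vf) :=
  LinearMap.range (homToWords k Vf x y ∘ₗ Fmap k Vf Irr x y)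

lemma chainWord_mem_wordRange {x y : V₀} (c : FactChain V₀ x y) (a : ↥(TFact k Vf Irr c)) :
    chainWord k Vf Irr c a ∈ wordRange k Vf Irr x y :=
  LinearMap.mem_range.2 ⟨_, (LinearMap.comp_apply _ _ _).trans (homToWords_Fmap_lof c a)⟩

lemma wordRange_le {x y : V₀} {S : Submodule k (WordAlg k Vf)}
    (hS : ∀ (c : FactChain V₀ x y) (a : ↥(TFact k Vf Irr c)), chainWord k Vf Irr c a ∈ S) :
    wordRange k Vf Irr x y ≤ S := by
  rintro _ ⟨f, rfl⟩
  induction f using DirectSum.induction_on with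
  | zero => rw [map_zero]; exact zero_mem _
  | add s t hs ht => rw [map_add]; exact add_mem hs ht
  | of c t =>
    rw [← DirectSum.lof_eq_of k, LinearMap.comp_apply, homToWords_Fmap_lof]
    exact hS c t

lemma mul_toWords_mem_wordRange {x y z : V₀} {s : WordAlg k Vf}
    (hs : s ∈ wordRange k Vf Irr x y) (u : OSeq V₀ y z) (hu : 0 < u.len)
    {b : ↥(Wspace k Vf u)} (hb : b ∈ Irr y z u) :
    s * toWords k Vf u b ∈ wordRange k Vf Irr x z := by
  have : wordRange k Vf Irr x y ≤ (wordRange k Vf Irr x z).comap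
      ((LinearMap.mul k (WordAlg k Vf)).flip (toWords k Vf u b)) := by
    refine wordRange_le fun c a => ?_
    have := chainWord_mem_wordRange (c.cons u hu)
      (a ⊗ₜ[k] ⟨b, hb⟩ : ↥(TFact k Vf Irr c) ⊗[k] ↥(Irr y z u))
    rw [chainWord_cons] at this
    exact this
  exact this hs

lemma mul_mem_wordRange {x y z : V₀} {s t : WordAlg k Vf}
    (hs : s ∈ wordRange k Vf Irr x y) (ht : t ∈ wordRange k Vf Irr y z) :
    s * t ∈ wordRange k Vf Irr x z := by
  have : wordRange k Vf Irr y z ≤ (wordRange k Vf Irr x z).comap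
      (LinearMap.mul k (WordAlg k Vf) s) := by
    refine wordRange_le fun c a => ?_
    clear ht
    change s * chainWord k Vf Irr c a ∈ wordRange k Vf Irr x _
    induction c with
    | nil =>
      change s * algebraMap k _ (show k from a) ∈ wordRange k Vf Irr x _
      rw [← Algebra.commutes, ← Algebra.smul_def]
      exact Submodule.smul_mem _ _ hs
    | @cons b z c u hu ih =>
      induction a using TFact_cons_induction with
      | zero =>
        rw [map_zero, mul_zero]
        exact zero_mem _
      | tmul a r =>
        rw [chainWord_cons, ← mul_assoc]
        exact mul_toWords_mem_wordRange (ih a) u hu r.2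
      | add r t hr ht =>
        rw [map_add, mul_add]
        exact add_mem hr ht
  exact this ht

lemma algebraMap_mem_wordRange (x : V₀) (a : k) :
    algebraMap k (WordAlg k Vf) a ∈ wordRange k Vf Irr x x :=
  chainWord_mem_wordRange (FactChain.nil x) (show ↥(TFact k Vf Irr (FactChain.nil x)) from a)

lemma toWords_mem_wordRange
    (hIrr : ∀ (x y : V₀) (u : OSeq V₀ x y), 0 < u.len →
      WInv k Vf ρ u ≤ Irr x y u ⊔ WComp k Vf ρ u)
    {x y : V₀} (u : OSeq V₀ x y) {a : ↥(Wspace k Vf u)} (ha : a ∈ WInv k Vf ρ u) :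
    toWords k Vf u a ∈ wordRange k Vf Irr x y := by
  induction hn : u.len using Nat.strong_induction_on generalizing x y u with
  | _ n ih =>
    subst hn
    rcases Nat.eq_zero_or_pos u.len with h0 | h0
    · cases u with
      | nil => exact algebraMap_mem_wordRange x _
      | snoc p c => exact absurd h0 (Nat.succ_ne_zero _)
    · have hle : Irr x y u ⊔ WComp k Vf ρ u ≤ (wordRange k Vf Irr x y).comap (toWords k Vf u) := by
        refine sup_le (fun b hb => ?_) (Submodule.span_le.2 ?_)
        · rw [Submodule.mem_comap, ← one_mul (toWords k Vf u b)]
          refine mul_toWords_mem_wordRange ?_ u h0 hb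
          rw [← map_one (algebraMap k (WordAlg k Vf))]
          exact algebraMap_mem_wordRange x 1
        · rintro _ ⟨y', u₁, u₂, rfl, h1, h2, b, hb, b', hb', rfl⟩
          rw [SetLike.mem_coe, Submodule.mem_comap]
          change toWords k Vf _ (mulW k Vf u₁ u₂ b b') ∈ wordRange k Vf Irr x y
          rw [toWords_mulW]
          rw [OSeq.len_comp] at ih
          exact mul_mem_wordRange (ih _ (by omega) u₁ hb' rfl) (ih _ (by omega) u₂ hb rfl)
      exact hle (hIrr _ _ _ h0 ha)

lemma InvHom_le_range_Fmap
    (hIrr : ∀ (x y : V₀) (u : OSeq V₀ x y), 0 < u.len →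
      WInv k Vf ρ u ≤ Irr x y u ⊔ WComp k Vf ρ u)
    (x y : V₀) : InvHom k Vf ρ x y ≤ LinearMap.range (Fmap k Vf Irr x y) := by
  refine iSup_le fun u => ?_
  rintro _ ⟨a, ha, rfl⟩
  obtain ⟨f, hf⟩ := toWords_mem_wordRange hIrr u ha
  refine ⟨f, homToWords_injective k Vf x y ?_⟩
  rw [homToWords_lof]
  exact hf

end InvariantCategory

/-- The invariants of a homogeneous action of a finite group on a free `k`-category
form a free `k`-category: the canonical functor `F : L_k(U) → L_k(V)^G` on the free
category over the chosen irreducible invariants is an isomorphism — on each morphism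
space it is injective with image exactly the invariants. -/
theorem invariants_of_free_linear_category_form_free_category
    (k : Type) [Field k] (G : Type) [Group G] [Finite G] (V₀ : Type)
    (Vf : V₀ → V₀ → Type) [∀ x y, AddCommGroup (Vf x y)] [∀ x y, Module k (Vf x y)]
    [∀ x y, FiniteDimensional k (Vf x y)]
    (ρ : ∀ x y : V₀, Representation k G (Vf x y))
    (Irr : ∀ (x y : V₀) (u : OSeq V₀ x y), Submodule k ↥(Wspace k Vf u))
    (hIrrNil : ∀ x : V₀, Irr x x (OSeq.nil x) = ⊥)
    (hIrr : ∀ (x y : V₀) (u : OSeq V₀ x y), 0 < u.len →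
      Irr x y u ⊓ WComp k Vf ρ u = ⊥ ∧ Irr x y u ⊔ WComp k Vf ρ u = WInv k Vf ρ u) :
    ∀ x y : V₀,
      Function.Injective (Fmap k Vf Irr x y) ∧
      LinearMap.range (Fmap k Vf Irr x y) = InvHom k Vf ρ x y := by
  intro x y
  refine ⟨Fmap_injective hIrr x y, le_antisymm (range_Fmap_le (fun x y u hu => ?_) x y)
    (InvHom_le_range_Fmap (fun x y u hu => (hIrr x y u hu).2.ge) x y)⟩
  exact le_sup_left.trans (hIrr x y u hu).2.le
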